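/- Let (X_k)_{k ≥ 1} be independent identically distributed real random variables with E[X_1] = 0, E[X_1²] = 1 and E[X_1⁴] < ∞, and set Q_n := n^{−1/2} Σ_{k=1}^n X_{2k−1} X_{2k}. Then d_W(Q_n, 𝒩) ≤ 8 E[X_1⁴] / √n. -/

import Mathlib

open MeasureTheory ProbabilityTheory

/-- Wasserstein distance between two laws on `ℝ`, as a supremum over
1-Lipschitz test functions. -/
noncomputable def dW (μ ν : Measure ℝ) : ℝ :=
  ⨆ h : {f : ℝ → ℝ // LipschitzWith 1 f}, |(∫ x, h.1 x ∂μ) - ∫ x, h.1 x ∂ν|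

/-- The standard Gaussian law `N(0,1)` on `ℝ`. -/
noncomputable def stdGaussian : Measure ℝ := gaussianReal 0 1

open Filter Topology

section GaussianWeight

/-- The unnormalised standard Gaussian density. -/
noncomputable def gaussWeight (x : ℝ) : ℝ := Real.exp (-(x ^ 2 / 2))

lemma gaussWeight_pos (x : ℝ) : 0 < gaussWeight x := Real.exp_pos _

lemma gaussWeight_neg (x : ℝ) : gaussWeight (-x) = gaussWeight x := by
  simp [gaussWeight]

lemma hasDerivAt_gaussWeight (x : ℝ) : HasDerivAt gaussWeight (-x * gaussWeight x) x := by
  have h : HasDerivAt (fun x : ℝ => -(x ^ 2 / 2)) (-x) x := by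
    have h1 := ((hasDerivAt_pow 2 x).div_const 2).neg
    refine h1.congr_deriv ?_
    norm_num
  have h2 := h.exp
  rw [mul_comm] at h2
  exact h2

lemma continuous_gaussWeight : Continuous gaussWeight := by
  unfold gaussWeight; fun_prop

lemma tendsto_mul_gaussWeight {l : Filter ℝ} (hl : Tendsto (fun x : ℝ => x ^ 2) l atTop)
    {u : ℝ → ℝ} {a b : ℝ} (hu : ∀ x, |u x| ≤ a + b * x ^ 2) :
    Tendsto (fun x => u x * gaussWeight x) l (𝓝 0) := by
  have hl' : Tendsto (fun x : ℝ => x ^ 2 / 2) l atTop := hl.atTop_div_const (by norm_num)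
  have h0 := (Real.tendsto_pow_mul_exp_neg_atTop_nhds_zero 0).comp hl'
  have h1 := (Real.tendsto_pow_mul_exp_neg_atTop_nhds_zero 1).comp hl'
  have h := (h0.const_mul a).add (h1.const_mul (2 * b))
  simp only [mul_zero, add_zero] at h
  refine squeeze_zero_norm (fun x => ?_) h
  rw [Real.norm_eq_abs, abs_mul, abs_of_pos (gaussWeight_pos x)]
  refine (mul_le_mul_of_nonneg_right (hu x) (gaussWeight_pos x).le).trans_eq ?_
  simp only [gaussWeight, Function.comp]
  ring

lemma tendsto_sq_atBot : Tendsto (fun x : ℝ => x ^ 2) atBot atTop := by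
  have h := (tendsto_pow_atTop (α := ℝ) (n := 2) (by norm_num)).comp tendsto_neg_atBot_atTop
  simpa [Function.comp_def] using h

lemma tendsto_sq_atTop : Tendsto (fun x : ℝ => x ^ 2) atTop atTop :=
  tendsto_pow_atTop (by norm_num)

lemma nonneg_of_hasDerivAt_nonpos_of_tendsto {G G' : ℝ → ℝ} {x : ℝ}
    (hG : ∀ t, HasDerivAt G (G' t) t) (hG' : ∀ t, x ≤ t → G' t ≤ 0)
    (hlim : Tendsto G atTop (𝓝 0)) : 0 ≤ G x := by
  have hanti : AntitoneOn G (Set.Ici x) :=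
    antitoneOn_of_hasDerivWithinAt_nonpos (convex_Ici x)
      (fun t _ => (hG t).continuousAt.continuousWithinAt)
      (fun t _ => (hG t).hasDerivWithinAt)
      (fun t ht => hG' t (interior_subset ht))
  refine le_of_tendsto hlim ((eventually_ge_atTop x).mono fun t ht => ?_)
  exact hanti (Set.mem_Ici.2 le_rfl) (Set.mem_Ici.2 ht) ht

lemma nonneg_of_hasDerivAt_nonneg_of_tendsto {G G' : ℝ → ℝ} {x : ℝ}
    (hG : ∀ t, HasDerivAt G (G' t) t) (hG' : ∀ t, t ≤ x → 0 ≤ G' t)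
    (hlim : Tendsto G atBot (𝓝 0)) : 0 ≤ G x := by
  have h := nonneg_of_hasDerivAt_nonpos_of_tendsto (G := fun t => G (-t))
    (G' := fun t => -G' (-t)) (x := -x)
    (fun t => by simpa [Function.comp_def] using (hG (-t)).comp t (hasDerivAt_neg t))
    (fun t ht => neg_nonpos.2 (hG' _ (by linarith)))
    (hlim.comp tendsto_neg_atTop_atBot)
  simpa using h

/-- A function vanishing at `±∞` whose derivative is the Gaussian weight times an antitone
function is nonnegative. -/
lemma nonneg_of_hasDerivAt_mul_antitone {G m : ℝ → ℝ}
    (hG : ∀ t, HasDerivAt G (m t * gaussWeight t) t) (hm : Antitone m)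
    (hbot : Tendsto G atBot (𝓝 0)) (htop : Tendsto G atTop (𝓝 0)) (x : ℝ) : 0 ≤ G x := by
  rcases le_total 0 (m x) with hx | hx
  · exact nonneg_of_hasDerivAt_nonneg_of_tendsto hG
      (fun t ht => mul_nonneg (hx.trans (hm ht)) (gaussWeight_pos t).le) hbot
  · exact nonneg_of_hasDerivAt_nonpos_of_tendsto hG
      (fun t ht => mul_nonpos_of_nonpos_of_nonneg ((hm ht).trans hx) (gaussWeight_pos t).le) htop

lemma mul_le_of_hasDerivAt_of_pos {g r : ℝ → ℝ} {K : ℝ}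
    (hg : ∀ t, HasDerivAt g (t * g t + r t) t) (hr : ∀ t, |r t| ≤ K)
    (hlim : Tendsto (fun t => g t * gaussWeight t) atTop (𝓝 0)) {x : ℝ} (hx : 0 < x) :
    x * g x ≤ K := by
  have hK : 0 ≤ K := (abs_nonneg _).trans (hr 0)
  have key := nonneg_of_hasDerivAt_nonpos_of_tendsto
    (G := fun t => K * gaussWeight t - x * (g t * gaussWeight t))
    (G' := fun t => (-(t * K) - x * r t) * gaussWeight t) (x := x)
    (fun t => by
      refine (((hasDerivAt_gaussWeight t).const_mul K).sub
        (((hg t).mul (hasDerivAt_gaussWeight t)).const_mul x)).congr_deriv ?_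
      ring)
    (fun t ht => by
      refine mul_nonpos_of_nonpos_of_nonneg ?_ (gaussWeight_pos t).le
      have h1 : -K ≤ r t := (abs_le.1 (hr t)).1
      nlinarith)
    (by
      have h1 := tendsto_mul_gaussWeight tendsto_sq_atTop (u := fun _ => K) (a := |K|) (b := 0)
        (by simp)
      simpa using h1.sub (hlim.const_mul x))
  have h2 : 0 ≤ (K - x * g x) * gaussWeight x := by
    refine key.trans_eq ?_
    ring
  have := nonneg_of_mul_nonneg_left h2 (gaussWeight_pos x)
  linarith

lemma abs_mul_le_of_hasDerivAt_of_pos {g r : ℝ → ℝ} {K : ℝ}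
    (hg : ∀ t, HasDerivAt g (t * g t + r t) t) (hr : ∀ t, |r t| ≤ K)
    (hlim : Tendsto (fun t => g t * gaussWeight t) atTop (𝓝 0)) {x : ℝ} (hx : 0 < x) :
    |x * g x| ≤ K := by
  refine abs_le.2 ⟨?_, mul_le_of_hasDerivAt_of_pos hg hr hlim hx⟩
  have h := mul_le_of_hasDerivAt_of_pos (g := fun t => -g t) (r := fun t => -r t)
    (fun t => (hg t).neg.congr_deriv (by ring)) (fun t => by simpa using hr t)
    (by simpa using hlim.neg) hx
  simp only [mul_neg] at h
  linarith

lemma abs_mul_le_of_hasDerivAt {g r : ℝ → ℝ} {K : ℝ}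
    (hg : ∀ t, HasDerivAt g (t * g t + r t) t) (hr : ∀ t, |r t| ≤ K)
    (htop : Tendsto (fun t => g t * gaussWeight t) atTop (𝓝 0))
    (hbot : Tendsto (fun t => g t * gaussWeight t) atBot (𝓝 0)) (x : ℝ) :
    |x * g x| ≤ K := by
  rcases lt_trichotomy x 0 with hx | rfl | hx
  · have h := abs_mul_le_of_hasDerivAt_of_pos (g := fun t => g (-t)) (r := fun t => -r (-t))
      (fun t => by
        have := (hg (-t)).comp t (hasDerivAt_neg t)
        refine this.congr_deriv ?_
        ring)
      (fun t => by simpa using hr (-t))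
      (by simpa [Function.comp_def, gaussWeight_neg] using hbot.comp tendsto_neg_atTop_atBot)
      (neg_pos.2 hx)
    simpa using h
  · simpa using (abs_nonneg _).trans (hr 0)
  · exact abs_mul_le_of_hasDerivAt_of_pos hg hr htop hx

end GaussianWeight

section SteinEquation

lemma LipschitzWith.abs_image_sub_le {h : ℝ → ℝ} (hh : LipschitzWith 1 h) (x y : ℝ) :
    |h x - h y| ≤ |x - y| := by
  simpa [Real.dist_eq] using hh.dist_le_mul x y

lemma LipschitzWith.abs_sub_const_le {h : ℝ → ℝ} (hh : LipschitzWith 1 h) (c x : ℝ) :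
    |h x - c| ≤ |h 0 - c| + |x| := by
  have h1 := hh.abs_image_sub_le x 0
  have h2 := abs_sub_le (h x) (h 0) c
  rw [sub_zero] at h1
  linarith

lemma LipschitzWith.integrable_of_integrable_id {h : ℝ → ℝ} (hh : LipschitzWith 1 h)
    {μ : Measure ℝ} [IsFiniteMeasure μ] (hμ : Integrable (fun x => x) μ) : Integrable h μ := by
  refine ((integrable_const |h 0|).add hμ.abs).mono' hh.continuous.aestronglyMeasurable
    (ae_of_all _ fun x => ?_)
  simpa using hh.abs_sub_const_le 0 x

instance : IsProbabilityMeasure stdGaussian := by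
  unfold _root_.stdGaussian; infer_instance

lemma integrable_id_stdGaussian : Integrable (fun x : ℝ => x) stdGaussian :=
  (memLp_id_gaussianReal 1).integrable (by norm_num)

lemma integral_stdGaussian_eq (u : ℝ → ℝ) :
    ∫ x, u x ∂stdGaussian = (Real.sqrt (2 * Real.pi))⁻¹ * ∫ x, u x * gaussWeight x := by
  rw [_root_.stdGaussian, integral_gaussianReal_eq_integral_smul one_ne_zero, ← integral_const_mul]
  congr 1 with x
  simp [gaussianPDFReal, gaussWeight, neg_div]
  ring

lemma integrable_sub_const_mul_gaussWeight {h : ℝ → ℝ} (hh : LipschitzWith 1 h) (c : ℝ) :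
    Integrable (fun x => (h x - c) * gaussWeight x) := by
  have e : gaussWeight = fun x => Real.exp (-(1 / 2) * x ^ 2) := by
    ext x; simp only [gaussWeight]; ring_nf
  have h0 : Integrable gaussWeight := by
    rw [e]; exact integrable_exp_neg_mul_sq (by norm_num)
  have h1 : Integrable (fun x => x * gaussWeight x) := by
    rw [e]; exact integrable_mul_exp_neg_mul_sq (by norm_num)
  refine ((h0.const_mul |h 0 - c|).add h1.abs).mono'
    ((hh.continuous.sub continuous_const).mul continuous_gaussWeight).aestronglyMeasurable
    (ae_of_all _ fun x => ?_)
  simp only [Pi.add_apply]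
  rw [Real.norm_eq_abs, abs_mul, abs_mul, abs_of_pos (gaussWeight_pos x), ← add_mul]
  exact mul_le_mul_of_nonneg_right (hh.abs_sub_const_le c x) (gaussWeight_pos x).le

lemma exists_gaussian_primitive {h : ℝ → ℝ} (hh : LipschitzWith 1 h) :
    ∃ F : ℝ → ℝ,
      (∀ x, HasDerivAt F ((h x - ∫ y, h y ∂stdGaussian) * gaussWeight x) x) ∧
      Tendsto F atBot (𝓝 0) ∧ Tendsto F atTop (𝓝 0) := by
  set c := ∫ y, h y ∂stdGaussian with hc
  set k : ℝ → ℝ := fun x => (h x - c) * gaussWeight x with hk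
  have hki : Integrable k := integrable_sub_const_mul_gaussWeight hh c
  have hkc : Continuous k := (hh.continuous.sub continuous_const).mul continuous_gaussWeight
  have hk0 : ∫ x, k x = 0 := by
    have h1 := integral_stdGaussian_eq (fun x => h x - c)
    rw [integral_sub (hh.integrable_of_integrable_id integrable_id_stdGaussian)
      (integrable_const c)] at h1
    simp only [integral_const, probReal_univ, one_smul, ← hc, sub_self] at h1
    have h2 : (Real.sqrt (2 * Real.pi))⁻¹ ≠ 0 := by positivity
    exact (mul_eq_zero.1 h1.symm).resolve_left h2
  refine ⟨fun x => (∫ t in Set.Iic 0, k t) + ∫ t in (0 : ℝ)..x, k t, fun x => ?_, ?_, ?_⟩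
  · exact (hkc.integral_hasStrictDerivAt 0 x).hasDerivAt.const_add _
  · have h1 := intervalIntegral_tendsto_integral_Iic (0 : ℝ) hki.integrableOn tendsto_id
    have h2 := (h1.neg).const_add (∫ t in Set.Iic 0, k t)
    simp only [id, ← intervalIntegral.integral_symm, add_neg_cancel] at h2
    exact h2
  · have h1 := intervalIntegral_tendsto_integral_Ioi (0 : ℝ) hki.integrableOn tendsto_id
    have h2 := h1.const_add (∫ t in Set.Iic 0, k t)
    rwa [intervalIntegral.integral_Iic_add_Ioi hki.integrableOn hki.integrableOn, hk0] at h2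

/-- A bounded solution of the Stein equation
for a Lipschitz datum `h`. -/
lemma exists_stein_solution {h : ℝ → ℝ} (hh : LipschitzWith 1 h) :
    ∃ f : ℝ → ℝ, (∀ x, HasDerivAt f (x * f x + (h x - ∫ y, h y ∂stdGaussian)) x) ∧
      ∀ x, |f x| ≤ 1 := by
  obtain ⟨F, hF, hbot, htop⟩ := exists_gaussian_primitive hh
  set c := ∫ y, h y ∂stdGaussian
  have hw {l : Filter ℝ} (hl : Tendsto (fun x : ℝ => x ^ 2) l atTop) :
      Tendsto gaussWeight l (𝓝 0) := by
    simpa using tendsto_mul_gaussWeight hl (u := fun _ => 1) (a := 1) (b := 0) (by simp)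
  have hle : ∀ x, 0 ≤ gaussWeight x - F x :=
    nonneg_of_hasDerivAt_mul_antitone (m := fun t => -t - (h t - c))
      (fun t => ((hasDerivAt_gaussWeight t).sub (hF t)).congr_deriv (by ring))
      (fun s t hst => by
        have h1 := (abs_le.1 (hh.abs_image_sub_le t s)).1
        rw [abs_of_nonneg (sub_nonneg.2 hst)] at h1
        show -t - (h t - c) ≤ -s - (h s - c)
        linarith)
      (by simpa using (hw tendsto_sq_atBot).sub hbot)
      (by simpa using (hw tendsto_sq_atTop).sub htop)
  have hge : ∀ x, 0 ≤ gaussWeight x + F x :=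
    nonneg_of_hasDerivAt_mul_antitone (m := fun t => -t + (h t - c))
      (fun t => ((hasDerivAt_gaussWeight t).add (hF t)).congr_deriv (by ring))
      (fun s t hst => by
        have h1 := (abs_le.1 (hh.abs_image_sub_le t s)).2
        rw [abs_of_nonneg (sub_nonneg.2 hst)] at h1
        show -t + (h t - c) ≤ -s + (h s - c)
        linarith)
      (by simpa using (hw tendsto_sq_atBot).add hbot)
      (by simpa using (hw tendsto_sq_atTop).add htop)
  refine ⟨fun x => F x / gaussWeight x, fun x => ?_, fun x => ?_⟩
  · have hne := (gaussWeight_pos x).ne'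
    refine ((hF x).div (hasDerivAt_gaussWeight x) hne).congr_deriv ?_
    field_simp
    ring
  · rw [abs_div, abs_of_pos (gaussWeight_pos x), div_le_one (gaussWeight_pos x), abs_le]
    constructor <;> linarith [hle x, hge x]

/-- For a differentiable Lipschitz datum, the Stein equation has a solution whose derivative
is `4`-Lipschitz. -/
lemma exists_stein_solution_lipschitz_deriv {h h' : ℝ → ℝ} (hh : LipschitzWith 1 h)
    (hd : ∀ x, HasDerivAt h (h' x) x) (hh' : ∀ x, |h' x| ≤ 1) :
    ∃ f f' : ℝ → ℝ, (∀ x, HasDerivAt f (f' x) x) ∧ (∀ x, |f x| ≤ 1) ∧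
      (∀ x y, |f' y - f' x| ≤ 4 * |y - x|) ∧
      ∀ x, f' x - x * f x = h x - ∫ y, h y ∂stdGaussian := by
  obtain ⟨f, hf, hf1⟩ := exists_stein_solution hh
  set c := ∫ y, h y ∂stdGaussian
  set g : ℝ → ℝ := fun x => x * f x + (h x - c) with hg
  have hgd : ∀ x, HasDerivAt g (x * g x + (f x + h' x)) x := fun x => by
    refine (((hasDerivAt_id x).mul (hf x)).add ((hd x).sub_const c)).congr_deriv ?_
    simp only [id, hg]
    ring
  have hr : ∀ x, |f x + h' x| ≤ 2 := fun x => by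
    have := abs_add_le (f x) (h' x)
    linarith [hf1 x, hh' x]
  have hgb : ∀ x, |g x| ≤ (|h 0 - c| + 1) + 1 * x ^ 2 := fun x => by
    have h1 := abs_add_le (x * f x) (h x - c)
    have h2 := hh.abs_sub_const_le c x
    have h3 : |x * f x| ≤ |x| := by
      rw [abs_mul]
      exact mul_le_of_le_one_right (abs_nonneg x) (hf1 x)
    have h4 : 2 * |x| ≤ 1 + x ^ 2 := by
      nlinarith [sq_nonneg (|x| - 1), sq_abs x]
    simp only [hg]
    linarith
  have hxg : ∀ x, |x * g x| ≤ 2 := abs_mul_le_of_hasDerivAt hgd hr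
    (tendsto_mul_gaussWeight tendsto_sq_atTop hgb) (tendsto_mul_gaussWeight tendsto_sq_atBot hgb)
  refine ⟨f, g, hf, hf1, fun x y => ?_, fun x => by simp [hg]⟩
  refine Convex.norm_image_sub_le_of_norm_hasDerivWithin_le (s := Set.univ)
    (fun t _ => (hgd t).hasDerivWithinAt) (fun t _ => ?_) convex_univ trivial trivial
  rw [Real.norm_eq_abs]
  have := abs_add_le (t * g t) (f t + h' t)
  linarith [hxg t, hr t]

end SteinEquation

section Smoothing

/-- A Lipschitz function is uniformly approximated by differentiable Lipschitz functions. -/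
lemma LipschitzWith.exists_hasDerivAt_approx {h : ℝ → ℝ} (hh : LipschitzWith 1 h) {ε : ℝ}
    (hε : 0 < ε) : ∃ k k' : ℝ → ℝ, LipschitzWith 1 k ∧ (∀ x, HasDerivAt k (k' x) x) ∧
      (∀ x, |k' x| ≤ 1) ∧ ∀ x, |k x - h x| ≤ ε := by
  have hcont := hh.continuous
  have hH (x : ℝ) : HasDerivAt (fun u => ∫ t in (0 : ℝ)..u, h t) (h x) x :=
    (hcont.integral_hasStrictDerivAt 0 x).hasDerivAt
  set k : ℝ → ℝ := fun x => ε⁻¹ * ((∫ t in (0 : ℝ)..(x + ε), h t) - ∫ t in (0 : ℝ)..x, h t)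
    with hk
  have hkd : ∀ x, HasDerivAt k (ε⁻¹ * (h (x + ε) - h x)) x := fun x =>
    (((hH (x + ε)).comp_add_const x ε).sub (hH x)).const_mul ε⁻¹
  have hk' : ∀ x, |ε⁻¹ * (h (x + ε) - h x)| ≤ 1 := fun x => by
    have h1 := hh.abs_image_sub_le (x + ε) x
    rw [add_sub_cancel_left, abs_of_pos hε] at h1
    rw [abs_mul, abs_of_pos (inv_pos.2 hε), inv_mul_le_iff₀ hε]
    simpa using h1
  refine ⟨k, _, ?_, hkd, hk', fun x => ?_⟩
  · refine LipschitzWith.of_dist_le_mul fun x y => ?_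
    exact Convex.norm_image_sub_le_of_norm_hasDerivWithin_le (s := Set.univ)
      (fun t _ => (hkd t).hasDerivWithinAt) (fun t _ => hk' t) convex_univ trivial trivial
  · have e : k x - h x = ε⁻¹ * ∫ t in x..(x + ε), (h t - h x) := by
      rw [intervalIntegral.integral_sub (hcont.intervalIntegrable _ _)
        intervalIntegrable_const, intervalIntegral.integral_const, hk,
        ← intervalIntegral.integral_interval_sub_left (hcont.intervalIntegrable 0 (x + ε))
          (hcont.intervalIntegrable 0 x)]
      simp only [add_sub_cancel_left, smul_eq_mul]
      field_simp
    have hb : ‖∫ t in x..(x + ε), (h t - h x)‖ ≤ ε * |x + ε - x| := by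
      refine intervalIntegral.norm_integral_le_of_norm_le_const fun t ht => ?_
      rw [Set.uIoc_of_le (by linarith)] at ht
      refine (hh.abs_image_sub_le t x).trans ?_
      rw [abs_of_pos (sub_pos.2 ht.1)]
      linarith [ht.2]
    rw [add_sub_cancel_left, abs_of_pos hε, Real.norm_eq_abs] at hb
    rw [e, abs_mul, abs_of_pos (inv_pos.2 hε), inv_mul_le_iff₀ hε]
    exact hb

end Smoothing

section SteinMethod

lemma abs_sub_sub_deriv_mul_le {f f' : ℝ → ℝ} {K : ℝ} (hf : ∀ x, HasDerivAt f (f' x) x)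
    (hK : 0 ≤ K) (hf' : ∀ x y, |f' y - f' x| ≤ K * |y - x|) (x y : ℝ) :
    |f (x + y) - f x - y * f' x| ≤ K * y ^ 2 := by
  have h := Convex.norm_image_sub_le_of_norm_hasDerivWithin_le
    (f := fun t => f t - t * f' x) (f' := fun t => f' t - f' x) (s := Set.uIcc x (x + y))
    (x := x) (y := x + y) (C := K * |y|)
    (fun t _ => by
      exact (((hf t).sub ((hasDerivAt_id t).mul_const (f' x))).congr_deriv
        (by simp)).hasDerivWithinAt)
    (fun t ht => by
      refine (hf' x t).trans (mul_le_mul_of_nonneg_left ?_ hK)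
      simpa using Set.abs_sub_left_of_mem_uIcc ht)
    (convex_uIcc _ _) Set.left_mem_uIcc Set.right_mem_uIcc
  simp only [Real.norm_eq_abs, add_sub_cancel_left] at h
  rw [mul_assoc, abs_mul_abs_self, ← sq] at h
  refine le_of_eq_of_le (congrArg abs ?_) h
  ring

variable {Ω : Type*} [MeasurableSpace Ω] {P : Measure Ω} [IsProbabilityMeasure P]

lemma integrable_comp_of_lipschitz {g : ℝ → ℝ} {K : ℝ} (hgc : Continuous g)
    (hg : ∀ x y, |g y - g x| ≤ K * |y - x|) {V : Ω → ℝ} (hV : Integrable V P) :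
    Integrable (fun ω => g (V ω)) P := by
  refine ((integrable_const |g 0|).add (hV.abs.const_mul K)).mono'
    (hgc.comp_aestronglyMeasurable hV.aestronglyMeasurable) (ae_of_all _ fun ω => ?_)
  have h1 := hg 0 (V ω)
  have h2 := abs_sub_abs_le_abs_sub (g (V ω)) (g 0)
  simp only [sub_zero] at h1
  simp only [Real.norm_eq_abs, Pi.add_apply]
  linarith

/-- The error made in the Stein identity by a single independent centered summand. -/
lemma abs_stein_summand_le {f f' : ℝ → ℝ} {K : ℝ} (hf : ∀ x, HasDerivAt f (f' x) x)
    (hf1 : ∀ x, |f x| ≤ 1) (hK : 0 ≤ K) (hf' : ∀ x y, |f' y - f' x| ≤ K * |y - x|)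
    {ξ V : Ω → ℝ} (hind : IndepFun V ξ P) (hV : Integrable V P)
    (hξ : Integrable ξ P) (hξ2 : Integrable (fun ω => ξ ω ^ 2) P)
    (hξ3 : Integrable (fun ω => |ξ ω| ^ 3) P) (hξ0 : ∫ ω, ξ ω ∂P = 0) :
    |(∫ ω, ξ ω ^ 2 ∂P) * (∫ ω, f' (V ω + ξ ω) ∂P) - ∫ ω, ξ ω * f (V ω + ξ ω) ∂P| ≤
      K * ((∫ ω, |ξ ω| ^ 3 ∂P) + (∫ ω, ξ ω ^ 2 ∂P) * ∫ ω, |ξ ω| ∂P) := by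
  have hfc : Continuous f := continuous_iff_continuousAt.2 fun x => (hf x).continuousAt
  have hf'c : Continuous f' := by
    refine (LipschitzWith.of_dist_le_mul (K := K.toNNReal) fun x y => ?_).continuous
    rw [Real.dist_eq, Real.dist_eq, Real.coe_toNNReal K hK]
    exact hf' y x
  have hW : Integrable (fun ω => V ω + ξ ω) P := hV.add hξ
  have iV' := integrable_comp_of_lipschitz hf'c hf' hV
  have iW' := integrable_comp_of_lipschitz hf'c hf' hW
  have iξfV : Integrable (fun ω => ξ ω * f (V ω)) P :=
    hξ.mul_bdd (c := 1) (hfc.comp_aestronglyMeasurable hV.aestronglyMeasurable)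
      (ae_of_all _ fun ω => hf1 _)
  have iξfW : Integrable (fun ω => ξ ω * f (V ω + ξ ω)) P :=
    hξ.mul_bdd (c := 1) (hfc.comp_aestronglyMeasurable hW.aestronglyMeasurable)
      (ae_of_all _ fun ω => hf1 _)
  have hind2 : IndepFun (fun ω => ξ ω ^ 2) (fun ω => f' (V ω)) P :=
    hind.symm.comp (φ := fun x => x ^ 2) (by fun_prop) hf'c.measurable
  have iξ2f : Integrable (fun ω => ξ ω ^ 2 * f' (V ω)) P := hind2.integrable_mul hξ2 iV'
  have e1 : ∫ ω, ξ ω ^ 2 * f' (V ω) ∂P = (∫ ω, ξ ω ^ 2 ∂P) * ∫ ω, f' (V ω) ∂P :=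
    hind2.integral_fun_mul_eq_mul_integral hξ2.aestronglyMeasurable iV'.aestronglyMeasurable
  have hind1 : IndepFun ξ (fun ω => f (V ω)) P :=
    hind.symm.comp measurable_id hfc.measurable
  have e2 : ∫ ω, ξ ω * f (V ω) ∂P = 0 := by
    rw [hind1.integral_fun_mul_eq_mul_integral hξ.aestronglyMeasurable
      (hfc.comp_aestronglyMeasurable hV.aestronglyMeasurable), hξ0, zero_mul]
  have b1 : |∫ ω, (ξ ω * f (V ω + ξ ω) - ξ ω * f (V ω) - ξ ω ^ 2 * f' (V ω)) ∂P| ≤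
      K * ∫ ω, |ξ ω| ^ 3 ∂P := by
    rw [← integral_const_mul]
    refine norm_integral_le_of_norm_le (f := fun ω =>
      ξ ω * f (V ω + ξ ω) - ξ ω * f (V ω) - ξ ω ^ 2 * f' (V ω))
      (hξ3.const_mul K) (ae_of_all _ fun ω => ?_)
    have h1 := abs_sub_sub_deriv_mul_le hf hK hf' (V ω) (ξ ω)
    have h2 : ξ ω * f (V ω + ξ ω) - ξ ω * f (V ω) - ξ ω ^ 2 * f' (V ω) =
      ξ ω * (f (V ω + ξ ω) - f (V ω) - ξ ω * f' (V ω)) := by ring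
    rw [h2, Real.norm_eq_abs, abs_mul]
    refine (mul_le_mul_of_nonneg_left h1 (abs_nonneg _)).trans_eq ?_
    rw [← sq_abs (ξ ω)]
    ring
  rw [integral_sub (f := fun ω => ξ ω * f (V ω + ξ ω) - ξ ω * f (V ω)) (iξfW.sub iξfV) iξ2f,
    integral_sub iξfW iξfV, e1, e2, sub_zero] at b1
  have b2 : |∫ ω, (f' (V ω + ξ ω) - f' (V ω)) ∂P| ≤ K * ∫ ω, |ξ ω| ∂P := by
    rw [← integral_const_mul]
    refine norm_integral_le_of_norm_le (f := fun ω => f' (V ω + ξ ω) - f' (V ω))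
      (hξ.abs.const_mul K) (ae_of_all _ fun ω => ?_)
    simpa using hf' (V ω) (V ω + ξ ω)
  rw [integral_sub iW' iV'] at b2
  have hs : 0 ≤ ∫ ω, ξ ω ^ 2 ∂P := integral_nonneg fun ω => sq_nonneg _
  set s := ∫ ω, ξ ω ^ 2 ∂P
  set A := ∫ ω, ξ ω * f (V ω + ξ ω) ∂P
  set B := ∫ ω, f' (V ω + ξ ω) ∂P
  set C := ∫ ω, f' (V ω) ∂P
  have e3 : s * B - A = s * (B - C) - (A - s * C) := by ring
  have b3 := abs_sub (s * (B - C)) (A - s * C)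
  rw [abs_mul, abs_of_nonneg hs] at b3
  have b4 := mul_le_mul_of_nonneg_left b2 hs
  rw [e3]
  linarith

/-- The Stein bound for sums of independent centered variables with total variance one. -/
theorem abs_integral_sub_stdGaussian_le_of_differentiable {ι : Type*} [DecidableEq ι]
    {s : Finset ι} {ξ : ι → Ω → ℝ}
    (h1 : ∀ i ∈ s, Integrable (ξ i) P)
    (h2 : ∀ i ∈ s, Integrable (fun ω => ξ i ω ^ 2) P)
    (h3 : ∀ i ∈ s, Integrable (fun ω => |ξ i ω| ^ 3) P)
    (h0 : ∀ i ∈ s, ∫ ω, ξ i ω ∂P = 0) (hvar : ∑ i ∈ s, ∫ ω, ξ i ω ^ 2 ∂P = 1)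
    (hind : ∀ i ∈ s, IndepFun (fun ω => ∑ j ∈ s.erase i, ξ j ω) (ξ i) P)
    {h h' : ℝ → ℝ} (hh : LipschitzWith 1 h)
    (hd : ∀ x, HasDerivAt h (h' x) x) (hh' : ∀ x, |h' x| ≤ 1) :
    |(∫ ω, h (∑ i ∈ s, ξ i ω) ∂P) - ∫ x, h x ∂stdGaussian| ≤
      ∑ i ∈ s, 4 * ((∫ ω, |ξ i ω| ^ 3 ∂P) + (∫ ω, ξ i ω ^ 2 ∂P) * ∫ ω, |ξ i ω| ∂P) := by
  obtain ⟨f, f', hf, hf1, hf', hst⟩ := exists_stein_solution_lipschitz_deriv hh hd hh'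
  set W : Ω → ℝ := fun ω => ∑ i ∈ s, ξ i ω with hW
  set c := ∫ x, h x ∂stdGaussian
  have hfc : Continuous f := continuous_iff_continuousAt.2 fun x => (hf x).continuousAt
  have iW : Integrable W P := integrable_finsetSum s h1
  have iξf : ∀ i ∈ s, Integrable (fun ω => ξ i ω * f (W ω)) P := fun i hi =>
    (h1 i hi).mul_bdd (c := 1) (hfc.comp_aestronglyMeasurable iW.aestronglyMeasurable)
      (ae_of_all _ fun ω => hf1 _)
  have iWf : Integrable (fun ω => W ω * f (W ω)) P :=
    iW.mul_bdd (c := 1) (hfc.comp_aestronglyMeasurable iW.aestronglyMeasurable)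
      (ae_of_all _ fun ω => hf1 _)
  have ihW : Integrable (fun ω => h (W ω)) P :=
    integrable_comp_of_lipschitz (K := 1) hh.continuous
      (fun x y => by simpa using hh.abs_image_sub_le y x) iW
  have eW : ∫ ω, W ω * f (W ω) ∂P = ∑ i ∈ s, ∫ ω, ξ i ω * f (W ω) ∂P := by
    rw [← integral_finsetSum s iξf]
    simp only [hW, Finset.sum_mul]
  have e1 : (∫ ω, h (W ω) ∂P) - c = (∫ ω, f' (W ω) ∂P) - ∫ ω, W ω * f (W ω) ∂P := by
    have h4 : ∀ ω, f' (W ω) = (h (W ω) - c) + W ω * f (W ω) := fun ω => by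
      linarith [hst (W ω)]
    simp only [h4]
    rw [integral_add (f := fun ω => h (W ω) - c) (ihW.sub (integrable_const c)) iWf,
      integral_sub ihW (integrable_const c)]
    simp
  have e2 : (∫ ω, h (W ω) ∂P) - c =
      ∑ i ∈ s, ((∫ ω, ξ i ω ^ 2 ∂P) * (∫ ω, f' (W ω) ∂P) - ∫ ω, ξ i ω * f (W ω) ∂P) := by
    rw [e1, eW, Finset.sum_sub_distrib, ← Finset.sum_mul, hvar, one_mul]
  rw [e2]
  refine (Finset.abs_sum_le_sum_abs _ _).trans (Finset.sum_le_sum fun i hi => ?_)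
  have hsplit : ∀ ω, W ω = (∑ j ∈ s.erase i, ξ j ω) + ξ i ω := fun ω =>
    (Finset.sum_erase_add s (fun j => ξ j ω) hi).symm
  simp only [hsplit]
  exact abs_stein_summand_le hf hf1 (by norm_num) hf' (hind i hi)
    (integrable_finsetSum _ fun j hj => h1 j (Finset.mem_of_mem_erase hj))
    (h1 i hi) (h2 i hi) (h3 i hi) (h0 i hi)

lemma dW_map_le_of_differentiable {W : Ω → ℝ} (hW : Measurable W) (hWi : Integrable W P) {B : ℝ}
    (hB : ∀ h h' : ℝ → ℝ, LipschitzWith 1 h → (∀ x, HasDerivAt h (h' x) x) →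
      (∀ x, |h' x| ≤ 1) → |(∫ ω, h (W ω) ∂P) - ∫ x, h x ∂stdGaussian| ≤ B) :
    dW (P.map W) stdGaussian ≤ B := by
  have : Nonempty {f : ℝ → ℝ // LipschitzWith 1 f} :=
    ⟨⟨fun x => x, LipschitzWith.id⟩⟩
  refine ciSup_le fun ⟨h, hh⟩ => ?_
  rw [integral_map hW.aemeasurable hh.continuous.aestronglyMeasurable]
  refine le_of_forall_pos_le_add fun ε hε => ?_
  obtain ⟨k, k', hk, hkd, hk', hkh⟩ := hh.exists_hasDerivAt_approx (half_pos hε)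
  have iW : ∀ u : ℝ → ℝ, LipschitzWith 1 u → Integrable (fun ω => u (W ω)) P := fun u hu =>
    integrable_comp_of_lipschitz (K := 1) hu.continuous
      (fun x y => by simpa using hu.abs_image_sub_le y x) hWi
  have iN : ∀ u : ℝ → ℝ, LipschitzWith 1 u → Integrable u stdGaussian := fun u hu =>
    hu.integrable_of_integrable_id integrable_id_stdGaussian
  have a1 : |(∫ ω, k (W ω) ∂P) - ∫ ω, h (W ω) ∂P| ≤ ε / 2 := by
    rw [← integral_sub (iW k hk) (iW h hh)]
    simpa using norm_integral_le_of_norm_le_const (μ := P) (f := fun ω => k (W ω) - h (W ω))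
      (ae_of_all _ fun ω => hkh (W ω))
  have a2 : |(∫ x, k x ∂stdGaussian) - ∫ x, h x ∂stdGaussian| ≤ ε / 2 := by
    rw [← integral_sub (iN k hk) (iN h hh)]
    simpa using norm_integral_le_of_norm_le_const (μ := stdGaussian) (f := fun x => k x - h x)
      (ae_of_all _ fun x => hkh x)
  have a3 := hB k k' hk hkd hk'
  rw [abs_le] at *
  constructor <;> linarith [a1.1, a1.2, a2.1, a2.2, a3.1, a3.2]

end SteinMethod

section IndependentProducts

variable {Ω : Type*} [MeasurableSpace Ω] {P : Measure Ω} {U V : Ω → ℝ}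

lemma ProbabilityTheory.IndepFun.pow_pow (hUV : IndepFun U V P) (a b : ℕ) :
    IndepFun (fun ω => U ω ^ a) (fun ω => V ω ^ b) P :=
  hUV.comp (φ := fun x => x ^ a) (ψ := fun x => x ^ b) (by fun_prop) (by fun_prop)

/-- Sums of products over disjoint pairs of indices of an independent family are independent. -/
lemma ProbabilityTheory.iIndepFun.indepFun_sum_pairs {X : ℕ → Ω → ℝ} (hX : iIndepFun X P)
    (hm : ∀ k, Measurable (X k)) (a : ℝ) {s : Finset ℕ} (hs : ∀ k ∈ s, 1 ≤ k) {i : ℕ}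
    (hi : 1 ≤ i) :
    IndepFun (fun ω => ∑ j ∈ s.erase i, a * (X (2 * j - 1) ω * X (2 * j) ω))
      (fun ω => a * (X (2 * i - 1) ω * X (2 * i) ω)) P := by
  set S : Finset ℕ := (s.erase i).biUnion fun j => {2 * j - 1, 2 * j} with hS
  set T : Finset ℕ := {2 * i - 1, 2 * i} with hT
  have hdisj : Disjoint S T := by
    rw [Finset.disjoint_left]
    intro x hx hx'
    simp only [hS, hT, Finset.mem_biUnion, Finset.mem_erase, Finset.mem_insert,
      Finset.mem_singleton] at hx hx'
    obtain ⟨j, ⟨hji, hjs⟩, hj⟩ := hx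
    have := hs j hjs
    omega
  have hS1 : ∀ j ∈ s.erase i, 2 * j - 1 ∈ S := fun j hj =>
    Finset.mem_biUnion.2 ⟨j, hj, by simp⟩
  have hS2 : ∀ j ∈ s.erase i, 2 * j ∈ S := fun j hj =>
    Finset.mem_biUnion.2 ⟨j, hj, by simp⟩
  have hT1 : 2 * i - 1 ∈ T := by simp [hT]
  have hT2 : 2 * i ∈ T := by simp [hT]
  have h := (hX.indepFun_finset S T hdisj hm).comp
    (φ := fun x : S → ℝ => ∑ j ∈ (s.erase i).attach,
      a * (x ⟨2 * j - 1, hS1 j j.2⟩ * x ⟨2 * j, hS2 j j.2⟩))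
    (ψ := fun x : T → ℝ => a * (x ⟨2 * i - 1, hT1⟩ * x ⟨2 * i, hT2⟩))
    (by fun_prop) (by fun_prop)
  convert h using 1
  · ext ω
    exact (Finset.sum_attach (s.erase i)
      (fun j => a * (X (2 * j - 1) ω * X (2 * j) ω))).symm
  · rfl

variable [IsProbabilityMeasure P]

lemma abs_mul_pow_three_le (a b : ℝ) :
    |a * b| ^ 3 ≤ (a ^ 4 * b ^ 2 + a ^ 2 * b ^ 4) / 2 := by
  have h4 : ∀ x : ℝ, x ^ 4 = |x| ^ 4 := fun x => (Even.pow_abs (by decide) x).symm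
  rw [abs_mul, h4 a, h4 b, ← sq_abs a, ← sq_abs b]
  nlinarith [mul_nonneg (sq_nonneg (|a| * |b|)) (sq_nonneg (|a| - |b|))]

lemma integrable_sq_of_integrable_pow_four (hU : Measurable U)
    (h4 : Integrable (fun ω => U ω ^ 4) P) : Integrable (fun ω => U ω ^ 2) P := by
  refine ((integrable_const 1).add h4).mono' (hU.pow_const 2).aestronglyMeasurable
    (ae_of_all _ fun ω => ?_)
  rw [Real.norm_eq_abs, abs_of_nonneg (sq_nonneg _)]
  simp only [Pi.add_apply]
  nlinarith [sq_nonneg (U ω ^ 2 - 1), sq_nonneg (U ω)]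

lemma integrable_of_integrable_sq (hU : Measurable U)
    (h2 : Integrable (fun ω => U ω ^ 2) P) : Integrable U P := by
  refine ((integrable_const 1).add h2).mono' hU.aestronglyMeasurable
    (ae_of_all _ fun ω => ?_)
  simp only [Pi.add_apply, Real.norm_eq_abs]
  nlinarith [sq_nonneg (|U ω| - 1), sq_abs (U ω), abs_nonneg (U ω)]

lemma integral_abs_le_one (hU : Measurable U)
    (h2 : Integrable (fun ω => U ω ^ 2) P) (hv : ∫ ω, U ω ^ 2 ∂P = 1) :
    ∫ ω, |U ω| ∂P ≤ 1 := by
  have h := integral_mono (integrable_of_integrable_sq hU h2).abs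
    (((integrable_const (1 : ℝ)).add h2).div_const 2)
    (fun ω => by
      simp only [Pi.add_apply]
      nlinarith [sq_nonneg (|U ω| - 1), sq_abs (U ω)])
  refine h.trans_eq ?_
  simp only [Pi.add_apply]
  rw [integral_div, integral_add (integrable_const _) h2, hv]
  norm_num

lemma one_le_integral_pow_four (h2 : Integrable (fun ω => U ω ^ 2) P)
    (h4 : Integrable (fun ω => U ω ^ 4) P) (hv : ∫ ω, U ω ^ 2 ∂P = 1) :
    1 ≤ ∫ ω, U ω ^ 4 ∂P := by
  have h := integral_mono ((h2.const_mul 2).sub (integrable_const (1 : ℝ))) h4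
    (fun ω => by
      simp only [Pi.sub_apply]
      nlinarith [sq_nonneg (U ω ^ 2 - 1)])
  refine le_trans (le_of_eq ?_) h
  simp only [Pi.sub_apply]
  rw [integral_sub (h2.const_mul 2) (integrable_const _), integral_const_mul, hv]
  norm_num

lemma ProbabilityTheory.IndepFun.integrable_abs_mul_pow_three (hUV : IndepFun U V P)
    (hU : Measurable U) (hV : Measurable V)
    (hU4 : Integrable (fun ω => U ω ^ 4) P) (hV4 : Integrable (fun ω => V ω ^ 4) P)
    {m : ℝ} (hU2 : ∫ ω, U ω ^ 2 ∂P = 1) (hV2 : ∫ ω, V ω ^ 2 ∂P = 1)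
    (hUm : ∫ ω, U ω ^ 4 ∂P = m) (hVm : ∫ ω, V ω ^ 4 ∂P = m) :
    Integrable (fun ω => |U ω * V ω| ^ 3) P ∧ ∫ ω, |U ω * V ω| ^ 3 ∂P ≤ m := by
  have iU2 := integrable_sq_of_integrable_pow_four hU hU4
  have iV2 := integrable_sq_of_integrable_pow_four hV hV4
  have i42 : Integrable (fun ω => U ω ^ 4 * V ω ^ 2) P := (hUV.pow_pow 4 2).integrable_mul hU4 iV2
  have i24 : Integrable (fun ω => U ω ^ 2 * V ω ^ 4) P := (hUV.pow_pow 2 4).integrable_mul iU2 hV4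
  have hsum : Integrable (fun ω => (U ω ^ 4 * V ω ^ 2 + U ω ^ 2 * V ω ^ 4) / 2) P :=
    (i42.add i24).div_const 2
  have hi : Integrable (fun ω => |U ω * V ω| ^ 3) P := by
    refine hsum.mono' (by fun_prop) (ae_of_all _ fun ω => ?_)
    rw [Real.norm_eq_abs, abs_of_nonneg (by positivity)]
    exact abs_mul_pow_three_le _ _
  refine ⟨hi, (integral_mono hi hsum fun ω => abs_mul_pow_three_le _ _).trans_eq ?_⟩
  rw [integral_div, integral_add i42 i24,
    (hUV.pow_pow 4 2).integral_fun_mul_eq_mul_integral hU4.aestronglyMeasurable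
      iV2.aestronglyMeasurable,
    (hUV.pow_pow 2 4).integral_fun_mul_eq_mul_integral iU2.aestronglyMeasurable
      hV4.aestronglyMeasurable, hU2, hV2, hUm, hVm]
  ring

end IndependentProducts

theorem pairs_quadratic_form_wasserstein_bound
    {Ω : Type*} [MeasureSpace Ω] [IsProbabilityMeasure (ℙ : Measure Ω)]
    (X : ℕ → Ω → ℝ)
    (hmeas : ∀ k, Measurable (X k))
    (hindep : iIndepFun X ℙ)
    (hiid : ∀ k l, IdentDistrib (X k) (X l) ℙ ℙ)
    (hcentered : ∫ ω, X 1 ω = 0)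
    (hvar : ∫ ω, (X 1 ω) ^ 2 = 1)
    (h4int : Integrable (fun ω => (X 1 ω) ^ 4))
    (n : ℕ) (hn : 0 < n) :
    dW (Measure.map
        (fun ω => (1 / Real.sqrt n) *
          ∑ k ∈ Finset.Icc 1 n, X (2 * k - 1) ω * X (2 * k) ω) ℙ)
      stdGaussian ≤
      8 * (∫ ω, (X 1 ω) ^ 4) / Real.sqrt n := by
  set m := ∫ ω, (X 1 ω) ^ 4 with hm
  set a : ℝ := 1 / Real.sqrt n with ha
  have hn' : (0 : ℝ) < n := Nat.cast_pos.2 hn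
  have ha0 : 0 < a := by positivity
  have hna : n * a ^ 2 = 1 := by
    rw [ha, div_pow, Real.sq_sqrt hn'.le]
    field_simp
  have hpow : ∀ k p, IdentDistrib (fun ω => X k ω ^ p) (fun ω => X 1 ω ^ p) ℙ ℙ := fun k p =>
    (hiid k 1).comp (u := fun x => x ^ p) (by fun_prop)
  have e1 : ∀ k, ∫ ω, X k ω = 0 := fun k => (hiid k 1).integral_eq.trans hcentered
  have e2 : ∀ k, ∫ ω, X k ω ^ 2 = 1 := fun k => (hpow k 2).integral_eq.trans hvar
  have e4 : ∀ k, ∫ ω, X k ω ^ 4 = m := fun k => (hpow k 4).integral_eq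
  have i4 : ∀ k, Integrable (fun ω => X k ω ^ 4) := fun k => (hpow k 4).integrable_iff.2 h4int
  have i2 : ∀ k, Integrable (fun ω => X k ω ^ 2) := fun k =>
    integrable_sq_of_integrable_pow_four (hmeas k) (i4 k)
  have i1 : ∀ k, Integrable (X k) := fun k => integrable_of_integrable_sq (hmeas k) (i2 k)
  have hm1 : 1 ≤ m := one_le_integral_pow_four (i2 1) h4int hvar
  have hpair : ∀ k ∈ Finset.Icc 1 n, IndepFun (X (2 * k - 1)) (X (2 * k)) := fun k hk =>
    hindep.indepFun (by have := (Finset.mem_Icc.1 hk).1; omega)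
  set Y : ℕ → Ω → ℝ := fun k ω => X (2 * k - 1) ω * X (2 * k) ω with hY
  have hYm : ∀ k, Measurable (Y k) := fun k => (hmeas _).mul (hmeas _)
  have iY : ∀ k ∈ Finset.Icc 1 n, Integrable (Y k) := fun k hk =>
    (hpair k hk).integrable_mul (i1 _) (i1 _)
  have eY : ∀ k ∈ Finset.Icc 1 n, ∫ ω, Y k ω = 0 := fun k hk => by
    rw [hY, (hpair k hk).integral_fun_mul_eq_mul_integral (i1 _).aestronglyMeasurable
      (i1 _).aestronglyMeasurable, e1, zero_mul]
  have iY2 : ∀ k ∈ Finset.Icc 1 n, Integrable (fun ω => Y k ω ^ 2) := fun k hk => by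
    simp only [hY, mul_pow]
    exact ((hpair k hk).pow_pow 2 2).integrable_mul (i2 _) (i2 _)
  have eY2 : ∀ k ∈ Finset.Icc 1 n, ∫ ω, Y k ω ^ 2 = 1 := fun k hk => by
    simp only [hY, mul_pow]
    rw [((hpair k hk).pow_pow 2 2).integral_fun_mul_eq_mul_integral (i2 _).aestronglyMeasurable
      (i2 _).aestronglyMeasurable, e2, e2, one_mul]
  have hY3 : ∀ k ∈ Finset.Icc 1 n, Integrable (fun ω => |Y k ω| ^ 3) ∧ ∫ ω, |Y k ω| ^ 3 ≤ m :=
    fun k hk => (hpair k hk).integrable_abs_mul_pow_three (hmeas _) (hmeas _) (i4 _) (i4 _)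
      (e2 _) (e2 _) (e4 _) (e4 _)
  have habs : ∀ k ω, |a * Y k ω| = a * |Y k ω| := fun k ω => by rw [abs_mul, abs_of_pos ha0]
  simp only [Finset.mul_sum]
  refine dW_map_le_of_differentiable (Finset.measurable_fun_sum _ fun k _ => (hYm k).const_mul a)
    (integrable_finsetSum _ fun k hk => (iY k hk).const_mul a) fun h h' hh hd hh' => ?_
  refine (abs_integral_sub_stdGaussian_le_of_differentiable (ξ := fun k ω => a * Y k ω)
    (fun k hk => (iY k hk).const_mul a)
    (fun k hk => by simpa only [mul_pow] using (iY2 k hk).const_mul (a ^ 2))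
    (fun k hk => by simpa only [habs, mul_pow] using (hY3 k hk).1.const_mul (a ^ 3))
    (fun k hk => by rw [integral_const_mul, eY k hk, mul_zero])
    (by
      simp only [mul_pow, integral_const_mul]
      rw [Finset.sum_congr rfl fun k hk => by rw [eY2 k hk, mul_one]]
      simpa using hna)
    (fun k hk => hindep.indepFun_sum_pairs hmeas a (fun j hj => (Finset.mem_Icc.1 hj).1)
      (Finset.mem_Icc.1 hk).1) hh hd hh').trans ?_
  have hterm : ∀ k ∈ Finset.Icc 1 n,
      4 * ((∫ ω, |a * Y k ω| ^ 3) + (∫ ω, (a * Y k ω) ^ 2) * ∫ ω, |a * Y k ω|) ≤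
        8 * m * a ^ 3 := fun k hk => by
    simp only [habs, mul_pow, integral_const_mul, eY2 k hk]
    have b3 := (hY3 k hk).2
    have b1 := integral_abs_le_one (hYm k) (iY2 k hk) (eY2 k hk)
    have hb : 0 ≤ a ^ 3 * (2 * m - (∫ ω, |Y k ω| ^ 3) - ∫ ω, |Y k ω|) :=
      mul_nonneg (by positivity) (by linarith)
    linarith
  refine (Finset.sum_le_sum hterm).trans_eq ?_
  rw [Finset.sum_const, Nat.card_Icc, nsmul_eq_mul, Nat.add_sub_cancel]
  calc n * (8 * m * a ^ 3) = 8 * m * a * (n * a ^ 2) := by ring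
    _ = 8 * m / Real.sqrt n := by rw [hna, ha]; ring
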